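/- Let G be a smallest counterexample (by number of vertices) to the statement 'every simple connected bridgeless cubic graph on n ≥ 8 vertices has an even factor of cost at most 1.3·n'. Then G contains no induced 5-circuit with a chord and an independent boundary (type 1 reducible subgraph). -/

import Mathlib

open SimpleGraph

variable {V : Type*}

noncomputable def deg (F : SimpleGraph V) (v : V) : ℕ := Nat.card (F.neighborSet v)

def IsCubic (G : SimpleGraph V) : Prop := ∀ v, deg G v = 3

def Bridgeless (G : SimpleGraph V) : Prop := ∀ e : Sym2 V, ¬ G.IsBridge e

def IsEvenFactor (G F : SimpleGraph V) : Prop := F ≤ G ∧ ∀ v, deg F v = 0 ∨ deg F v = 2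

def Is2Factor (G F : SimpleGraph V) : Prop := F ≤ G ∧ ∀ v, deg F v = 2

noncomputable def numIso (F : SimpleGraph V) : ℕ := Nat.card {v : V // deg F v = 0}

def IsCircuitOf (F : SimpleGraph V) (C : Set V) : Prop :=
  ∃ v, deg F v ≠ 0 ∧ C = {u | F.Reachable v u}

noncomputable def numCirc (F : SimpleGraph V) : ℕ := Nat.card {C : Set V // IsCircuitOf F C}

noncomputable def cost [Fintype V] (F : SimpleGraph V) : ℝ :=
  (Fintype.card V : ℝ) + 2 * (numCirc F : ℝ) + (numIso F : ℝ)

def bdry (G : SimpleGraph V) (S : Set V) : Set (Sym2 V) :=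
  {e | ∃ u v, e = s(u, v) ∧ G.Adj u v ∧ u ∈ S ∧ v ∉ S}

noncomputable def bdryCard (G : SimpleGraph V) (S : Set V) : ℕ := Nat.card ↥(bdry G S)

noncomputable def bdryCount (G F : SimpleGraph V) (S : Set V) : ℕ :=
  Nat.card ↥(bdry G S ∩ F.edgeSet)


def IndepBoundary (G : SimpleGraph V) (S : Set V) : Prop :=
  (bdry G S).Pairwise fun e f => ∀ v : V, v ∈ e → v ∉ f

def HasSpanningCycle (G : SimpleGraph V) (S : Set V) : Prop :=
  ∃ (a : V) (w : G.Walk a a), w.IsCycle ∧ ∀ v : V, v ∈ w.support ↔ v ∈ S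

noncomputable def inducedEdges (G : SimpleGraph V) (S : Set V) : ℕ :=
  Nat.card {e : Sym2 V // e ∈ G.edgeSet ∧ ∀ v ∈ e, v ∈ S}

def IsInducedCircuit (G : SimpleGraph V) (S : Set V) (k : ℕ) : Prop :=
  HasSpanningCycle G S ∧ Nat.card S = k ∧ inducedEdges G S = k

def Touches (A B : Set V) : Prop := (A ∩ B).Nonempty ∧ (A \ B).Nonempty

def IsDiamond8 (G : SimpleGraph V) (S : Set V) : Prop :=
  HasSpanningCycle G S ∧ Nat.card S = 8 ∧ inducedEdges G S = 11

def IsDiamond6 (G : SimpleGraph V) (S : Set V) : Prop :=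
  HasSpanningCycle G S ∧ Nat.card S = 6 ∧ inducedEdges G S = 8 ∧
    ¬ ∃ T, IsDiamond8 G T ∧ S ⊆ T

def IsDiamond4 (G : SimpleGraph V) (S : Set V) : Prop :=
  HasSpanningCycle G S ∧ Nat.card S = 4 ∧ inducedEdges G S = 5 ∧
    ¬ ∃ T, IsDiamond6 G T ∧ S ⊆ T

def HasTriangleIn (G : SimpleGraph V) (S : Set V) : Prop :=
  ∃ a b c, a ∈ S ∧ b ∈ S ∧ c ∈ S ∧ G.Adj a b ∧ G.Adj b c ∧ G.Adj a c

def Type1Red (G : SimpleGraph V) (S : Set V) : Prop :=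
  HasSpanningCycle G S ∧ Nat.card S = 5 ∧ inducedEdges G S = 6 ∧ IndepBoundary G S

def Type3Red (G : SimpleGraph V) (S : Set V) : Prop :=
  HasSpanningCycle G S ∧ Nat.card S = 7 ∧ inducedEdges G S = 9 ∧
    (∃ D, IsDiamond4 G D ∧ D ⊆ S) ∧ IndepBoundary G S

def Type4Red (G : SimpleGraph V) (S : Set V) : Prop :=
  HasSpanningCycle G S ∧ Nat.card S = 6 ∧ inducedEdges G S = 7 ∧ HasTriangleIn G S

def IrreducibleGraph (G : SimpleGraph V) : Prop :=
  ¬ ∃ S : Set V, Type1Red G S ∨ IsDiamond8 G S ∨ Type3Red G S ∨ Type4Red G S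

def InCstar (G : SimpleGraph V) (T : Set V) : Prop :=
  IsInducedCircuit G T 4 ∨ IsInducedCircuit G T 5

def C4coll (G : SimpleGraph V) : Set (Set V) :=
  {S | IsInducedCircuit G S 4 ∧ IndepBoundary G S}

def C5coll (G : SimpleGraph V) : Set (Set V) :=
  {S | IsInducedCircuit G S 5 ∧ IndepBoundary G S}

def C6coll (G : SimpleGraph V) : Set (Set V) :=
  {S | IsInducedCircuit G S 6 ∧ IndepBoundary G S}

def NoTouchCstar (G : SimpleGraph V) (S : Set V) : Prop :=
  ¬ ∃ T, InCstar G T ∧ Touches S T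

def C4noint (G : SimpleGraph V) : Set (Set V) := {S | S ∈ C4coll G ∧ NoTouchCstar G S}
def C5noint (G : SimpleGraph V) : Set (Set V) := {S | S ∈ C5coll G ∧ NoTouchCstar G S}
def C6noint (G : SimpleGraph V) : Set (Set V) := {S | S ∈ C6coll G ∧ NoTouchCstar G S}

def C44noint (G : SimpleGraph V) : Set (Set V) :=
  {S | HasSpanningCycle G S ∧ Nat.card S = 6 ∧ inducedEdges G S = 7 ∧
       ¬ HasTriangleIn G S ∧ NoTouchCstar G S}

def C4int5 (G : SimpleGraph V) : Set (Set V) :=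
  {S | S ∈ C4coll G ∧ (∃ T, IsInducedCircuit G T 5 ∧ Touches S T) ∧
       ¬ ∃ T, (IsInducedCircuit G T 4 ∨ IsInducedCircuit G T 6) ∧ Touches S T}

def D4coll (G : SimpleGraph V) : Set (Set V) := {S | IsDiamond4 G S}
def D6coll (G : SimpleGraph V) : Set (Set V) := {S | IsDiamond6 G S}

/-- `G` is a counterexample to: every simple connected bridgeless cubic graph on
`n ≥ 8` vertices has an even factor of cost at most `1.3 n`. -/
def IsCounterexample (n : ℕ) (G : SimpleGraph (Fin n)) : Prop :=
  G.Connected ∧ IsCubic G ∧ Bridgeless G ∧ 8 ≤ n ∧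
    ¬ ∃ F : SimpleGraph (Fin n), IsEvenFactor G F ∧ cost F ≤ 1.3 * (n : ℝ)

section Degree

theorem deg_eq_ncard (F : SimpleGraph V) (v : V) : deg F v = (F.neighborSet v).ncard := rfl

theorem deg_eq_two_of_adj_iff {F : SimpleGraph V} {v p q : V} (hpq : p ≠ q)
    (h : ∀ x, F.Adj v x ↔ x = p ∨ x = q) : deg F v = 2 := by
  rw [deg_eq_ncard, Set.ncard_eq_two]
  exact ⟨p, q, hpq, Set.ext fun x => by simpa using h x⟩

theorem deg_eq_three_of_adj_iff {F : SimpleGraph V} {v p q r : V} (hpq : p ≠ q) (hpr : p ≠ r)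
    (hqr : q ≠ r) (h : ∀ x, F.Adj v x ↔ x = p ∨ x = q ∨ x = r) : deg F v = 3 := by
  rw [deg_eq_ncard, Set.ncard_eq_three]
  exact ⟨p, q, r, hpq, hpr, hqr, Set.ext fun x => by simpa using h x⟩

theorem exists_adj_iff_of_deg_eq_two {F : SimpleGraph V} {v : V} (h : deg F v = 2) :
    ∃ p q, p ≠ q ∧ ∀ x, F.Adj v x ↔ x = p ∨ x = q := by
  rw [deg_eq_ncard, Set.ncard_eq_two] at h
  obtain ⟨p, q, hpq, h⟩ := h
  exact ⟨p, q, hpq, fun x => by simpa using Set.ext_iff.1 h x⟩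

theorem exists_adj_iff_of_deg_eq_three {F : SimpleGraph V} {v : V} (h : deg F v = 3) :
    ∃ p q r, p ≠ q ∧ p ≠ r ∧ q ≠ r ∧ ∀ x, F.Adj v x ↔ x = p ∨ x = q ∨ x = r := by
  rw [deg_eq_ncard, Set.ncard_eq_three] at h
  obtain ⟨p, q, r, hpq, hpr, hqr, h⟩ := h
  exact ⟨p, q, r, hpq, hpr, hqr, fun x => by simpa using Set.ext_iff.1 h x⟩

theorem exists_third_neighbor {F : SimpleGraph V} {v p q : V} (h : deg F v = 3) (hpq : p ≠ q)
    (hp : F.Adj v p) (hq : F.Adj v q) :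
    ∃ r, p ≠ r ∧ q ≠ r ∧ ∀ x, F.Adj v x ↔ x = p ∨ x = q ∨ x = r := by
  obtain ⟨a, b, c, hab, hac, hbc, h⟩ := exists_adj_iff_of_deg_eq_three h
  rw [h] at hp hq
  simp only [h]
  rcases hp with rfl | rfl | rfl <;> rcases hq with rfl | rfl | rfl <;>
    first
    | exact absurd rfl hpq
    | exact ⟨a, by tauto, by tauto, by tauto⟩
    | exact ⟨b, by tauto, by tauto, by tauto⟩
    | exact ⟨c, by tauto, by tauto, by tauto⟩

theorem adj_iff_of_deg_eq_three {F : SimpleGraph V} {v p q r : V} (h : deg F v = 3)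
    (hpq : p ≠ q) (hpr : p ≠ r) (hqr : q ≠ r)
    (hp : F.Adj v p) (hq : F.Adj v q) (hr : F.Adj v r) (x : V) :
    F.Adj v x ↔ x = p ∨ x = q ∨ x = r := by
  obtain ⟨t, -, -, h⟩ := exists_third_neighbor h hpq hp hq
  grind

theorem deg_ne_zero_iff [Finite V] {F : SimpleGraph V} {v : V} :
    deg F v ≠ 0 ↔ ∃ x, F.Adj v x := by
  rw [deg_eq_ncard, ← Nat.pos_iff_ne_zero, Set.ncard_pos]
  exact Iff.rfl

end Degree

section Contraction

variable {W : Type*}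

/-- The map `π` contracts exactly `S` to a single point, and every vertex outside `S` is joined
to at most one vertex of `S`; hence contracting `S` in `G` creates no parallel edges. -/
structure IsSimpleContraction (G : SimpleGraph V) (S : Set V) (π : V → W) : Prop where
  surjective : Function.Surjective π
  eq_iff : ∀ u v, π u = π v ↔ u = v ∨ u ∈ S ∧ v ∈ S
  eq_of_adj : ∀ u u' v, u ∈ S → u' ∈ S → v ∉ S → G.Adj u v → G.Adj u' v → u = u'

namespace IsSimpleContraction

variable {G : SimpleGraph V} {S : Set V} {π : V → W}

theorem eq_of_notMem (hπ : IsSimpleContraction G S π) {u v : V} (hu : u ∉ S) (h : π u = π v) :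
    u = v := by
  rcases (hπ.eq_iff u v).1 h with h | h
  · exact h
  · exact absurd h.1 hu

/-- Every edge of the contracted graph is the image of only one edge. -/
theorem edge_unique (hπ : IsSimpleContraction G S π) {u v u' v' : V} (h : G.Adj u v)
    (h' : G.Adj u' v') (hu : π u = π u') (hv : π v = π v') (hne : π u ≠ π v) :
    u = u' ∧ v = v' := by
  have h1 := (hπ.eq_iff u u').1 hu
  have h2 := (hπ.eq_iff v v').1 hv
  have h3 := mt (hπ.eq_iff u v).2 hne
  have h4 := hπ.eq_of_adj u u' v
  have h5 := hπ.eq_of_adj v v' u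
  have := h.symm
  have := h'.symm
  grind

theorem map_adj_of_notMem (hπ : IsSimpleContraction G S π) {u v : V} (hu : u ∉ S)
    (h : G.Adj u v) : (G.map π).Adj (π u) (π v) :=
  ⟨fun e => h.ne (hπ.eq_of_notMem hu e), u, v, h, rfl, rfl⟩

theorem exists_adj_of_map_adj (hπ : IsSimpleContraction G S π) {u : V} (hu : u ∉ S) {y : W}
    (h : (G.map π).Adj (π u) y) : ∃ v, G.Adj u v ∧ π v = y := by
  obtain ⟨-, u', v, h, e, rfl⟩ := h
  obtain rfl := hπ.eq_of_notMem hu e.symm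
  exact ⟨v, h, rfl⟩

theorem injOn_neighborSet (hπ : IsSimpleContraction G S π) {u : V} (hu : u ∉ S) :
    Set.InjOn π (G.neighborSet u) := fun _ hv _ hv' e =>
  (hπ.edge_unique hv hv' rfl e (fun e => G.ne_of_adj hv (hπ.eq_of_notMem hu e))).2

theorem deg_map_of_notMem (hπ : IsSimpleContraction G S π) {u : V} (hu : u ∉ S) :
    deg (G.map π) (π u) = deg G u := by
  rw [deg_eq_ncard, deg_eq_ncard, ← (hπ.injOn_neighborSet hu).ncard_image]
  congr 1
  ext y
  constructor
  · exact fun h => hπ.exists_adj_of_map_adj hu h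
  · rintro ⟨v, hv, rfl⟩
    exact hπ.map_adj_of_notMem hu hv

theorem reachable_map {F : SimpleGraph V} {F' : SimpleGraph W}
    (h : ∀ u v, F.Adj u v → F'.Reachable (π u) (π v)) {u v : V} (huv : F.Reachable u v) :
    F'.Reachable (π u) (π v) := by
  obtain ⟨p⟩ := huv
  induction p with
  | nil => rfl
  | cons hadj _ ih => exact (h _ _ hadj).trans ih

theorem reachable_of_map {F : SimpleGraph V} {F' : SimpleGraph W}
    (hfib : ∀ u v, π u = π v → F.Reachable u v)
    (hadj : ∀ x y, F'.Adj x y → ∃ u v, π u = x ∧ π v = y ∧ F.Adj u v)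
    {u v : V} (huv : F'.Reachable (π u) (π v)) : F.Reachable u v := by
  obtain ⟨p⟩ := huv
  generalize hx : π u = x at p
  generalize hy : π v = y at p
  induction p generalizing u with
  | nil => exact hfib _ _ (hx.trans hy.symm)
  | cons h _ ih =>
    obtain ⟨a, b, ha, hb, hab⟩ := hadj _ _ h
    exact ((hfib _ _ (hx.trans ha.symm)).trans hab.reachable).trans (ih hb hy)

theorem connected_map (hπ : IsSimpleContraction G S π) (hG : G.Connected) :
    (G.map π).Connected := by
  have := hG.nonempty.map π
  refine ⟨fun x y => ?_⟩
  obtain ⟨u, rfl⟩ := hπ.surjective x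
  obtain ⟨v, rfl⟩ := hπ.surjective y
  refine reachable_map (fun a b hab => ?_) (hG u v)
  by_cases e : π a = π b
  · rw [e]
  · exact Adj.reachable ⟨e, a, b, hab, rfl, rfl⟩

theorem bridgeless_map (hπ : IsSimpleContraction G S π) (hG : G.Connected)
    (hb : Bridgeless G) : Bridgeless (G.map π) := by
  intro e
  induction e with
  | h x y =>
  rw [isBridge_iff, not_not]
  by_cases hxy : (G.map π).Adj x y
  · obtain ⟨hne, u, v, huv, rfl, rfl⟩ := hxy
    refine reachable_map (F := G.deleteEdges {s(u, v)}) (fun a b hab => ?_)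
      (not_not.1 (hb s(u, v)))
    rw [deleteEdges_adj] at hab
    by_cases e : π a = π b
    · rw [e]
    refine Adj.reachable ?_
    rw [deleteEdges_adj]
    refine ⟨⟨e, a, b, hab.1, rfl, rfl⟩, fun h => hab.2 ?_⟩
    rcases Sym2.eq_iff.1 h with ⟨h1, h2⟩ | ⟨h1, h2⟩
    · obtain ⟨rfl, rfl⟩ := hπ.edge_unique hab.1 huv h1 h2 e
      rfl
    · obtain ⟨rfl, rfl⟩ := hπ.edge_unique hab.1 huv.symm h1 h2 e
      exact Sym2.eq_swap
  · have h : (G.map π).deleteEdges {s(x, y)} = G.map π := by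
      rw [deleteEdges_eq_self, Set.disjoint_singleton_right]
      exact hxy
    rw [h]
    exact (hπ.connected_map hG) x y

/-- The lift of a subgraph `F'` of the contracted graph, completed by a graph `P` inside the
contracted set. -/
def lift (G : SimpleGraph V) (π : V → W) (P : SimpleGraph V) (F' : SimpleGraph W) :
    SimpleGraph V := P ⊔ (G ⊓ F'.comap π)

theorem lift_adj {P : SimpleGraph V} {F' : SimpleGraph W} {u v : V} :
    (lift G π P F').Adj u v ↔ P.Adj u v ∨ G.Adj u v ∧ F'.Adj (π u) (π v) := Iff.rfl

variable {P : SimpleGraph V} {F' : SimpleGraph W}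

theorem deg_lift_of_notMem (hπ : IsSimpleContraction G S π) (hF' : F' ≤ G.map π)
    (hP : ∀ u v, P.Adj u v → u ∈ S ∧ v ∈ S) {u : V} (hu : u ∉ S) :
    deg (lift G π P F') u = deg F' (π u) := by
  have hsub : (lift G π P F').neighborSet u ⊆ G.neighborSet u := fun v hv =>
    (lift_adj.1 hv).elim (fun h => absurd (hP _ _ h).1 hu) And.left
  rw [deg_eq_ncard, deg_eq_ncard,
    ← ((hπ.injOn_neighborSet hu).mono hsub).ncard_image]
  congr 1
  ext y
  constructor
  · rintro ⟨v, hv, rfl⟩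
    exact (lift_adj.1 hv).elim (fun h => absurd (hP _ _ h).1 hu) And.right
  · intro hy
    obtain ⟨v, hv, rfl⟩ := hπ.exists_adj_of_map_adj hu (hF' hy)
    exact ⟨v, lift_adj.2 (Or.inr ⟨hv, hy⟩), rfl⟩

theorem reachable_lift_iff (hπ : IsSimpleContraction G S π) (hF' : F' ≤ G.map π)
    (hP : ∀ u v, P.Adj u v → u ∈ S ∧ v ∈ S) (hPS : ∀ u ∈ S, ∀ v ∈ S, P.Reachable u v) (u v : V) :
    (lift G π P F').Reachable u v ↔ F'.Reachable (π u) (π v) := by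
  constructor
  · refine reachable_map fun a b hab => ?_
    rcases lift_adj.1 hab with h | h
    · rw [(hπ.eq_iff a b).2 (Or.inr (hP _ _ h))]
    · exact h.2.reachable
  · refine reachable_of_map (fun a b hab => ?_) fun x y hxy => ?_
    · rcases (hπ.eq_iff a b).1 hab with rfl | h
      · rfl
      · exact (hPS a h.1 b h.2).mono le_sup_left
    · obtain ⟨-, a, b, hab, rfl, rfl⟩ := hF' hxy
      exact ⟨a, b, rfl, rfl, lift_adj.2 (Or.inr ⟨hab, hxy⟩)⟩

theorem isEvenFactor_lift (hπ : IsSimpleContraction G S π) (hF' : IsEvenFactor (G.map π) F')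
    (hPG : P ≤ G) (hP : ∀ u v, P.Adj u v → u ∈ S ∧ v ∈ S)
    (hdeg : ∀ v ∈ S, deg (lift G π P F') v = 2) : IsEvenFactor G (lift G π P F') := by
  refine ⟨sup_le hPG inf_le_left, fun v => ?_⟩
  by_cases hv : v ∈ S
  · exact Or.inr (hdeg v hv)
  · rw [hπ.deg_lift_of_notMem hF'.1 hP hv]
    exact hF'.2 _

theorem numIso_lift (hπ : IsSimpleContraction G S π) [Finite W] (hF' : F' ≤ G.map π)
    (hP : ∀ u v, P.Adj u v → u ∈ S ∧ v ∈ S)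
    (hdeg : ∀ v ∈ S, deg (lift G π P F') v = 2) {a : V} (ha : a ∈ S) :
    numIso (lift G π P F') ≤ ({w | deg F' w = 0} \ {π a}).ncard := by
  have hS : ∀ v, deg (lift G π P F') v = 0 → v ∉ S := fun v hv hvS => by
    rw [hdeg v hvS] at hv
    exact two_ne_zero hv
  refine Set.ncard_le_ncard_of_injOn (s := {v | deg (lift G π P F') v = 0}) π ?_ ?_ (Set.toFinite _)
  · intro v hv
    have hvS := hS v hv
    refine ⟨?_, fun e => hvS (hπ.eq_of_notMem hvS e ▸ ha)⟩
    rw [Set.mem_ofPred_eq, ← hπ.deg_lift_of_notMem hF' hP hvS]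
    exact hv
  · exact fun u hu v _ e => hπ.eq_of_notMem (hS u hu) e

theorem numCirc_lift (hπ : IsSimpleContraction G S π) [Finite W] (hF' : F' ≤ G.map π)
    (hP : ∀ u v, P.Adj u v → u ∈ S ∧ v ∈ S) (hPS : ∀ u ∈ S, ∀ v ∈ S, P.Reachable u v)
    {a : V} (ha : a ∈ S) :
    numCirc (lift G π P F') ≤
      (insert {w | F'.Reachable (π a) w} {C | IsCircuitOf F' C}).ncard := by
  have hsub : {C | IsCircuitOf (lift G π P F') C} ⊆
      (Set.preimage π) '' (insert {w | F'.Reachable (π a) w} {C | IsCircuitOf F' C}) := by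
    rintro _ ⟨v, hv, rfl⟩
    refine ⟨{w | F'.Reachable (π v) w}, ?_, ?_⟩
    · by_cases hvS : v ∈ S
      · exact Or.inl (by rw [(hπ.eq_iff v a).2 (Or.inr ⟨hvS, ha⟩)])
      · exact Or.inr ⟨π v, by rwa [← hπ.deg_lift_of_notMem hF' hP hvS], rfl⟩
    · ext u
      exact (hπ.reachable_lift_iff hF' hP hPS v u).symm
  exact (Set.ncard_le_ncard hsub (Set.toFinite _)).trans (Set.ncard_image_le (Set.toFinite _))

/-- Lifting an even factor costs one unit per additional vertex, and one more unit when the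
contracted vertex was isolated. -/
theorem cost_lift [Fintype V] [Fintype W] (hπ : IsSimpleContraction G S π)
    (hF' : F' ≤ G.map π)
    (hP : ∀ u v, P.Adj u v → u ∈ S ∧ v ∈ S) (hPS : ∀ u ∈ S, ∀ v ∈ S, P.Reachable u v)
    (hdeg : ∀ v ∈ S, deg (lift G π P F') v = 2) {a : V} (ha : a ∈ S) :
    cost (lift G π P F') ≤ cost F' + (Fintype.card V - Fintype.card W : ℝ) +
      (if deg F' (π a) = 0 then 1 else 0) := by
  have h1 := hπ.numIso_lift hF' hP hdeg ha
  have h2 := hπ.numCirc_lift hF' hP hPS ha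
  have e1 : numIso F' = {w | deg F' w = 0}.ncard := rfl
  have e2 : numCirc F' = {C | IsCircuitOf F' C}.ncard := rfl
  unfold cost
  split_ifs with h
  · have h3 := Set.ncard_sdiff_singleton_add_one (a := π a) (s := {w | deg F' w = 0}) h
      (Set.toFinite _)
    have h4 := Set.ncard_insert_le {w | F'.Reachable (π a) w} {C | IsCircuitOf F' C}
    have h5 : (numIso (lift G π P F') : ℝ) + 1 ≤ numIso F' := by
      exact_mod_cast (by omega : _ + 1 ≤ _)
    have h6 : (numCirc (lift G π P F') : ℝ) ≤ numCirc F' + 1 := by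
      exact_mod_cast (by omega : _ ≤ _ + 1)
    linarith
  · rw [Set.insert_eq_of_mem (show _ ∈ {C | IsCircuitOf F' C} from ⟨π a, h, rfl⟩), ← e2] at h2
    have h3 := Set.ncard_le_ncard (Set.sdiff_subset (s := {w | deg F' w = 0}) (t := {π a}))
      (Set.toFinite _)
    have h5 : (numIso (lift G π P F') : ℝ) ≤ numIso F' := by
      exact_mod_cast (by omega : _ ≤ _)
    have h6 : (numCirc (lift G π P F') : ℝ) ≤ numCirc F' := by exact_mod_cast h2
    linarith

end IsSimpleContraction

end Contraction

section House

variable {W : Type*} {G : SimpleGraph V} {S : Set V} {π : V → W} {F' : SimpleGraph W}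

open IsSimpleContraction

theorem exists_evenFactor_of_path [Fintype V] [Fintype W] (hπ : IsSimpleContraction G S π)
    (hF' : IsEvenFactor (G.map π) F') {b₀ b₁ b₂ b₃ b₄ y y' : V}
    (hnd : [b₀, b₁, b₂, b₃, b₄].Nodup) (hS : S = {b₀, b₁, b₂, b₃, b₄})
    (h₀₁ : G.Adj b₀ b₁) (h₁₂ : G.Adj b₁ b₂) (h₂₃ : G.Adj b₂ b₃) (h₃₄ : G.Adj b₃ b₄)
    (hy : y ∉ S) (hy' : y' ∉ S)
    (e₀ : ∀ u, G.Adj b₀ u ∧ F'.Adj (π b₀) (π u) ↔ u = y)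
    (e₁ : ∀ u, ¬ (G.Adj b₁ u ∧ F'.Adj (π b₁) (π u)))
    (e₂ : ∀ u, ¬ (G.Adj b₂ u ∧ F'.Adj (π b₂) (π u)))
    (e₃ : ∀ u, ¬ (G.Adj b₃ u ∧ F'.Adj (π b₃) (π u)))
    (e₄ : ∀ u, G.Adj b₄ u ∧ F'.Adj (π b₄) (π u) ↔ u = y') :
    ∃ F, IsEvenFactor G F ∧ cost F ≤ cost F' + (Fintype.card V - Fintype.card W : ℝ) := by
  let P : SimpleGraph V := fromEdgeSet {s(b₀, b₁), s(b₁, b₂), s(b₂, b₃), s(b₃, b₄)}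
  have hPadj : ∀ u v, P.Adj u v ↔ (s(u, v) = s(b₀, b₁) ∨ s(u, v) = s(b₁, b₂) ∨
      s(u, v) = s(b₂, b₃) ∨ s(u, v) = s(b₃, b₄)) ∧ u ≠ v := fun u v => by
    simp [P]
  simp only [Sym2.eq_iff] at hPadj
  have hPG : P ≤ G := by
    intro u v huv
    rw [hPadj] at huv
    have := h₀₁.symm
    have := h₁₂.symm
    have := h₂₃.symm
    have := h₃₄.symm
    grind
  have hP : ∀ u v, P.Adj u v → u ∈ S ∧ v ∈ S := by
    intro u v huv
    rw [hPadj] at huv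
    simp only [hS, Set.mem_insert_iff, Set.mem_singleton_iff]
    grind
  have r₁ : P.Reachable b₀ b₁ := Adj.reachable (by rw [hPadj]; grind)
  have r₂ : P.Reachable b₀ b₂ := r₁.trans (Adj.reachable (by rw [hPadj]; grind))
  have r₃ : P.Reachable b₀ b₃ := r₂.trans (Adj.reachable (by rw [hPadj]; grind))
  have r₄ : P.Reachable b₀ b₄ := r₃.trans (Adj.reachable (by rw [hPadj]; grind))
  have r : ∀ u ∈ S, P.Reachable b₀ u := by
    intro u hu
    simp only [hS, Set.mem_insert_iff, Set.mem_singleton_iff] at hu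
    rcases hu with rfl | rfl | rfl | rfl | rfl
    exacts [.rfl, r₁, r₂, r₃, r₄]
  have hPS : ∀ u ∈ S, ∀ v ∈ S, P.Reachable u v := fun u hu v hv => (r u hu).symm.trans (r v hv)
  have hb₀ : b₀ ∈ S := by simp [hS]
  have hdeg : ∀ v ∈ S, deg (lift G π P F') v = 2 := by
    intro v hv
    simp only [hS, Set.mem_insert_iff, Set.mem_singleton_iff] at hv hy hy'
    rcases hv with rfl | rfl | rfl | rfl | rfl
    · refine deg_eq_two_of_adj_iff (p := b₁) (q := y) (by grind) fun u => ?_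
      rw [lift_adj, e₀, hPadj]; grind
    · refine deg_eq_two_of_adj_iff (p := b₀) (q := b₂) (by grind) fun u => ?_
      rw [lift_adj, or_iff_left (e₁ u), hPadj]; grind
    · refine deg_eq_two_of_adj_iff (p := b₁) (q := b₃) (by grind) fun u => ?_
      rw [lift_adj, or_iff_left (e₂ u), hPadj]; grind
    · refine deg_eq_two_of_adj_iff (p := b₂) (q := b₄) (by grind) fun u => ?_
      rw [lift_adj, or_iff_left (e₃ u), hPadj]; grind
    · refine deg_eq_two_of_adj_iff (p := b₃) (q := y') (by grind) fun u => ?_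
      rw [lift_adj, e₄, hPadj]; grind
  have hne : deg F' (π b₀) ≠ 0 := deg_ne_zero_iff.2 ⟨π y, ((e₀ y).2 rfl).2⟩
  refine ⟨_, hπ.isEvenFactor_lift hF' hPG hP hdeg, ?_⟩
  simpa [hne] using hπ.cost_lift hF'.1 hP hPS hdeg hb₀

theorem exists_evenFactor_of_cycle [Fintype V] [Fintype W] (hπ : IsSimpleContraction G S π)
    (hF' : IsEvenFactor (G.map π) F') {b₀ b₁ b₂ b₃ b₄ : V}
    (hnd : [b₀, b₁, b₂, b₃, b₄].Nodup) (hS : S = {b₀, b₁, b₂, b₃, b₄})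
    (h₀₁ : G.Adj b₀ b₁) (h₁₂ : G.Adj b₁ b₂) (h₂₃ : G.Adj b₂ b₃) (h₃₄ : G.Adj b₃ b₄)
    (h₄₀ : G.Adj b₄ b₀) (hiso : deg F' (π b₀) = 0) :
    ∃ F, IsEvenFactor G F ∧ cost F ≤ cost F' + (Fintype.card V - Fintype.card W : ℝ) + 1 := by
  let P : SimpleGraph V :=
    fromEdgeSet {s(b₀, b₁), s(b₁, b₂), s(b₂, b₃), s(b₃, b₄), s(b₄, b₀)}
  have hPadj : ∀ u v, P.Adj u v ↔ (s(u, v) = s(b₀, b₁) ∨ s(u, v) = s(b₁, b₂) ∨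
      s(u, v) = s(b₂, b₃) ∨ s(u, v) = s(b₃, b₄) ∨ s(u, v) = s(b₄, b₀)) ∧ u ≠ v := fun u v => by
    simp [P]
  simp only [Sym2.eq_iff] at hPadj
  have hPG : P ≤ G := by
    intro u v huv
    rw [hPadj] at huv
    have := h₀₁.symm
    have := h₁₂.symm
    have := h₂₃.symm
    have := h₃₄.symm
    have := h₄₀.symm
    grind
  have hP : ∀ u v, P.Adj u v → u ∈ S ∧ v ∈ S := by
    intro u v huv
    rw [hPadj] at huv
    simp only [hS, Set.mem_insert_iff, Set.mem_singleton_iff]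
    grind
  have r₁ : P.Reachable b₀ b₁ := Adj.reachable (by rw [hPadj]; grind)
  have r₂ : P.Reachable b₀ b₂ := r₁.trans (Adj.reachable (by rw [hPadj]; grind))
  have r₃ : P.Reachable b₀ b₃ := r₂.trans (Adj.reachable (by rw [hPadj]; grind))
  have r₄ : P.Reachable b₀ b₄ := r₃.trans (Adj.reachable (by rw [hPadj]; grind))
  have r : ∀ u ∈ S, P.Reachable b₀ u := by
    intro u hu
    simp only [hS, Set.mem_insert_iff, Set.mem_singleton_iff] at hu
    rcases hu with rfl | rfl | rfl | rfl | rfl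
    exacts [.rfl, r₁, r₂, r₃, r₄]
  have hPS : ∀ u ∈ S, ∀ v ∈ S, P.Reachable u v := fun u hu v hv => (r u hu).symm.trans (r v hv)
  have hb₀ : b₀ ∈ S := by simp [hS]
  have hdeg : ∀ v ∈ S, deg (lift G π P F') v = 2 := by
    intro v hv
    have e : ∀ u, ¬ (G.Adj v u ∧ F'.Adj (π v) (π u)) := by
      rintro u ⟨-, h⟩
      rw [(hπ.eq_iff v b₀).2 (Or.inr ⟨hv, hb₀⟩)] at h
      exact deg_ne_zero_iff.2 ⟨_, h⟩ hiso
    simp only [hS, Set.mem_insert_iff, Set.mem_singleton_iff] at hv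
    rcases hv with rfl | rfl | rfl | rfl | rfl
    · refine deg_eq_two_of_adj_iff (p := b₁) (q := b₄) (by grind) fun u => ?_
      rw [lift_adj, or_iff_left (e u), hPadj]; grind
    · refine deg_eq_two_of_adj_iff (p := b₀) (q := b₂) (by grind) fun u => ?_
      rw [lift_adj, or_iff_left (e u), hPadj]; grind
    · refine deg_eq_two_of_adj_iff (p := b₁) (q := b₃) (by grind) fun u => ?_
      rw [lift_adj, or_iff_left (e u), hPadj]; grind
    · refine deg_eq_two_of_adj_iff (p := b₂) (q := b₄) (by grind) fun u => ?_
      rw [lift_adj, or_iff_left (e u), hPadj]; grind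
    · refine deg_eq_two_of_adj_iff (p := b₃) (q := b₀) (by grind) fun u => ?_
      rw [lift_adj, or_iff_left (e u), hPadj]; grind
  refine ⟨_, hπ.isEvenFactor_lift hF' hPG hP hdeg, ?_⟩
  simpa [hiso] using hπ.cost_lift hF'.1 hP hPS hdeg hb₀

/-- The vertices `p, q, r, s, t` of `S` form a triangle `p q r` and a quadrangle `q r s t` sharing
the edge `q r`, and `x`, `y`, `z` are distinct outer neighbors of `p`, `s`, `t`. -/
structure IsHouse (G : SimpleGraph V) (S : Set V) (p q r s t x y z : V) : Prop where
  nodup : [p, q, r, s, t, x, y, z].Nodup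
  eq_S : S = {p, q, r, s, t}
  adj_p : ∀ u, G.Adj p u ↔ u = q ∨ u = r ∨ u = x
  adj_q : ∀ u, G.Adj q u ↔ u = p ∨ u = r ∨ u = t
  adj_r : ∀ u, G.Adj r u ↔ u = p ∨ u = q ∨ u = s
  adj_s : ∀ u, G.Adj s u ↔ u = r ∨ u = t ∨ u = y
  adj_t : ∀ u, G.Adj t u ↔ u = q ∨ u = s ∨ u = z

namespace IsHouse

variable {p q r s t x y z : V}

theorem mem_iff (hH : IsHouse G S p q r s t x y z) (u : V) :
    u ∈ S ↔ u = p ∨ u = q ∨ u = r ∨ u = s ∨ u = t := by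
  simp [hH.eq_S]

theorem map_adj_iff (hH : IsHouse G S p q r s t x y z) (hπ : IsSimpleContraction G S π) (w : W) :
    (G.map π).Adj (π p) w ↔ w = π x ∨ w = π y ∨ w = π z := by
  obtain ⟨hnd, -, hp, hq, hr, hs, ht⟩ := id hH
  have hm := hH.mem_iff
  have hx : x ∉ S := by grind
  have hy : y ∉ S := by grind
  have hz : z ∉ S := by grind
  have hpS : p ∈ S := by grind
  have hc : ∀ u ∈ S, π u = π p := fun u hu => (hπ.eq_iff u p).2 (Or.inr ⟨hu, hpS⟩)
  constructor
  · rintro ⟨hne, u, v, huv, hu, rfl⟩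
    have hv : v ∉ S := fun hv => hne (hc v hv).symm
    have huS : u ∈ S := by
      rcases (hπ.eq_iff u p).1 hu with rfl | h
      exacts [hpS, h.1]
    suffices v = x ∨ v = y ∨ v = z by grind
    rw [hm] at huS hv
    rcases huS with rfl | rfl | rfl | rfl | rfl <;> grind
  · rintro (rfl | rfl | rfl)
    · exact (hπ.map_adj_of_notMem hx ((hp x).2 (by simp)).symm).symm
    · rw [← hc s (by grind)]
      exact (hπ.map_adj_of_notMem hy ((hs y).2 (by simp)).symm).symm
    · rw [← hc t (by grind)]
      exact (hπ.map_adj_of_notMem hz ((ht z).2 (by simp)).symm).symm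

theorem isCubic_map (hH : IsHouse G S p q r s t x y z) (hπ : IsSimpleContraction G S π)
    (hG : IsCubic G) : IsCubic (G.map π) := by
  intro w
  obtain ⟨u, rfl⟩ := hπ.surjective w
  by_cases hu : u ∈ S
  · have hnd := hH.nodup
    have hm := hH.mem_iff
    rw [(hπ.eq_iff u p).2 (Or.inr ⟨hu, by grind⟩)]
    refine deg_eq_three_of_adj_iff ?_ ?_ ?_ (hH.map_adj_iff hπ)
    · exact fun e => absurd (hπ.eq_of_notMem (by grind) e) (by grind)
    · exact fun e => absurd (hπ.eq_of_notMem (by grind) e) (by grind)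
    · exact fun e => absurd (hπ.eq_of_notMem (by grind) e) (by grind)
  · rw [hπ.deg_map_of_notMem hu]
    exact hG u

set_option maxHeartbeats 1000000 in
/-- An even factor of the contracted graph lifts to the graph, using a Hamiltonian path of the
house if the contracted vertex is covered, and its 5-circuit otherwise. -/
theorem exists_evenFactor [Fintype V] [Fintype W] (hH : IsHouse G S p q r s t x y z)
    (hπ : IsSimpleContraction G S π) (hF' : IsEvenFactor (G.map π) F') :
    ∃ F, IsEvenFactor G F ∧ cost F ≤ cost F' + (Fintype.card V - Fintype.card W : ℝ) +
      (if deg F' (π p) = 0 then 1 else 0) := by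
  obtain ⟨hnd, hS, hp, hq, hr, hs, ht⟩ := id hH
  have hm := hH.mem_iff
  have hpS : p ∈ S := by grind
  have hc : ∀ u ∈ S, π u = π p := fun u hu => (hπ.eq_iff u p).2 (Or.inr ⟨hu, hpS⟩)
  have hqc := hc q (by grind)
  have hrc := hc r (by grind)
  have hsc := hc s (by grind)
  have htc := hc t (by grind)
  rcases hF'.2 (π p) with h0 | h2
  · rw [if_pos h0]
    refine exists_evenFactor_of_cycle hπ hF' (b₀ := p) (b₁ := r) (b₂ := s) (b₃ := t) (b₄ := q)
      (by grind) ?_ (by grind) (by grind) (by grind) (by grind) (by grind) h0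
    ext u
    simp only [hm, Set.mem_insert_iff, Set.mem_singleton_iff]
    tauto
  · rw [if_neg (by omega), add_zero]
    obtain ⟨w, w', hne, hw⟩ := exists_adj_iff_of_deg_eq_two h2
    have hirr := F'.irrefl (v := π p)
    have hwH := (hH.map_adj_iff hπ w).1 (hF'.1 ((hw w).2 (Or.inl rfl)))
    have hwH' := (hH.map_adj_iff hπ w').1 (hF'.1 ((hw w').2 (Or.inr rfl)))
    have hxy : π x ≠ π y := fun e => absurd (hπ.eq_of_notMem (by grind) e) (by grind)
    have hxz : π x ≠ π z := fun e => absurd (hπ.eq_of_notMem (by grind) e) (by grind)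
    have hyz : π y ≠ π z := fun e => absurd (hπ.eq_of_notMem (by grind) e) (by grind)
    have key : (F'.Adj (π p) (π x) ∧ F'.Adj (π p) (π y) ∧ ¬ F'.Adj (π p) (π z)) ∨
        (F'.Adj (π p) (π x) ∧ ¬ F'.Adj (π p) (π y) ∧ F'.Adj (π p) (π z)) ∨
        (¬ F'.Adj (π p) (π x) ∧ F'.Adj (π p) (π y) ∧ F'.Adj (π p) (π z)) := by
      rw [hw, hw, hw]
      rcases hwH with rfl | rfl | rfl <;> rcases hwH' with rfl | rfl | rfl <;>
        simp_all [eq_comm]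
    clear hw hwH hwH' hne h2
    have op : ∀ u, G.Adj p u ∧ F'.Adj (π p) (π u) ↔ u = x ∧ F'.Adj (π p) (π x) := by grind
    have oq : ∀ u, ¬ (G.Adj q u ∧ F'.Adj (π q) (π u)) := by grind
    have orr : ∀ u, ¬ (G.Adj r u ∧ F'.Adj (π r) (π u)) := by grind
    have os : ∀ u, G.Adj s u ∧ F'.Adj (π s) (π u) ↔ u = y ∧ F'.Adj (π p) (π y) := by grind
    have ot : ∀ u, G.Adj t u ∧ F'.Adj (π t) (π u) ↔ u = z ∧ F'.Adj (π p) (π z) := by grind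
    rcases key with h | h | h
    · refine exists_evenFactor_of_path hπ hF' (b₀ := p) (b₁ := r) (b₂ := q) (b₃ := t) (b₄ := s)
        (y := x) (y' := y) (by grind) ?_ (by grind) (by grind) (by grind) (by grind) (by grind)
        (by grind) (by simpa [h] using op) orr oq
        (by simpa [h] using ot) (by simpa [h] using os)
      ext u
      simp only [hm, Set.mem_insert_iff, Set.mem_singleton_iff]
      tauto
    · refine exists_evenFactor_of_path hπ hF' (b₀ := p) (b₁ := q) (b₂ := r) (b₃ := s) (b₄ := t)
        (y := x) (y' := z) (by grind) ?_ (by grind) (by grind) (by grind) (by grind) (by grind)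
        (by grind) (by simpa [h] using op) oq orr
        (by simpa [h] using os) (by simpa [h] using ot)
      ext u
      simp only [hm, Set.mem_insert_iff, Set.mem_singleton_iff]
    · refine exists_evenFactor_of_path hπ hF' (b₀ := s) (b₁ := r) (b₂ := p) (b₃ := q) (b₄ := t)
        (y := y) (y' := z) (by grind) ?_ (by grind) (by grind) (by grind) (by grind) (by grind)
        (by grind) (by simpa [h] using os) orr (by simpa [h] using op)
        oq (by simpa [h] using ot)
      ext u
      simp only [hm, Set.mem_insert_iff, Set.mem_singleton_iff]
      tauto

end IsHouse

end House

section SmallCubic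

theorem exists_evenFactor_of_hamiltonian {k : ℕ} {H : SimpleGraph (Fin (k + 3))}
    {σ : Fin (k + 3) → Fin (k + 3)} (hσ : Function.Injective σ)
    (hadj : ∀ i, H.Adj (σ i) (σ (i + 1))) :
    ∃ F, IsEvenFactor H F ∧ (∀ v, deg F v = 2) ∧ cost F ≤ (k + 3 : ℕ) + 2 := by
  let e : Fin (k + 3) ≃ Fin (k + 3) := Equiv.ofBijective σ (Finite.injective_iff_bijective.1 hσ)
  let φ : cycleGraph (k + 3) ≃g (cycleGraph (k + 3)).map e := Iso.map e _
  have hdeg : ∀ v, deg ((cycleGraph (k + 3)).map e) v = 2 := by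
    intro v
    obtain ⟨u, rfl⟩ := φ.surjective v
    rw [deg, ← Nat.card_congr (φ.mapNeighborSet u), Nat.card_eq_fintype_card,
      card_neighborSet_eq_degree, cycleGraph_degree_three_le]
  have hconn : ((cycleGraph (k + 3)).map e).Connected := φ.connected_iff.1 cycleGraph_connected
  have hle : (cycleGraph (k + 3)).map e ≤ H := by
    rintro _ _ ⟨-, u, v, huv, rfl, rfl⟩
    rcases cycleGraph_adj.1 huv with h | h
    · obtain rfl := sub_eq_iff_eq_add.1 h
      rw [add_comm 1 v]
      exact (hadj v).symm
    · obtain rfl := sub_eq_iff_eq_add.1 h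
      rw [add_comm 1 u]
      exact hadj u
  refine ⟨_, ⟨hle, fun v => Or.inr (hdeg v)⟩, hdeg, ?_⟩
  have h1 : numIso ((cycleGraph (k + 3)).map e) = 0 := by
    rw [numIso, Nat.card_eq_zero]
    exact Or.inl ⟨fun v => by simpa [hdeg v.1] using v.2⟩
  have h2 : numCirc ((cycleGraph (k + 3)).map e) ≤ 1 := by
    rw [numCirc, Finite.card_le_one_iff_subsingleton]
    refine ⟨fun C D => Subtype.ext ?_⟩
    obtain ⟨_, u, -, rfl⟩ := C
    obtain ⟨_, v, -, rfl⟩ := D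
    ext x
    exact iff_of_true (hconn u x) (hconn v x)
  have h3 : (numCirc ((cycleGraph (k + 3)).map e) : ℝ) ≤ 1 := by exact_mod_cast h2
  rw [cost, h1, Fintype.card_fin]
  push_cast
  linarith

theorem even_card_of_isCubic [Fintype V] {H : SimpleGraph V} (hH : IsCubic H) :
    Even (Fintype.card V) := by
  classical
  have h := H.even_card_odd_degree_vertices
  have hd : ∀ v, H.degree v = 3 := fun v => by
    rw [← card_neighborSet_eq_degree, ← Nat.card_eq_fintype_card]
    exact hH v
  simpa [hd, show Odd 3 by decide] using h

/-- In a cubic graph on six vertices every vertex has exactly two non-neighbors. -/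
theorem exists_not_adj_iff_of_isCubic_six {H : SimpleGraph (Fin 6)} (hH : IsCubic H)
    (v : Fin 6) : ∃ p q, p ≠ q ∧ p ≠ v ∧ q ≠ v ∧ ∀ x, H.Adj v x ↔ x ≠ v ∧ x ≠ p ∧ x ≠ q := by
  classical
  have hd : deg Hᶜ v = 2 := by
    have h := hH v
    have h' := H.degree_compl v
    simp only [← card_neighborSet_eq_degree, ← Nat.card_eq_fintype_card] at h'
    rw [deg] at h ⊢
    rw [h', h, Nat.card_fin]
  obtain ⟨p, q, hpq, h⟩ := exists_adj_iff_of_deg_eq_two hd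
  simp only [compl_adj] at h
  have hp := (h p).2 (Or.inl rfl)
  have hq := (h q).2 (Or.inr rfl)
  have hv := H.irrefl (v := v)
  exact ⟨p, q, hpq, hp.1.symm, hq.1.symm, fun x => by have := h x; grind⟩

theorem exists_hamiltonian_of_isCubic_six {H : SimpleGraph (Fin 6)} (hH : IsCubic H) :
    ∃ a b c d e f, [a, b, c, d, e, f].Nodup ∧ H.Adj a b ∧ H.Adj b c ∧ H.Adj c d ∧ H.Adj d e ∧
      H.Adj e f ∧ H.Adj f a := by
  obtain ⟨d, e, hde, hd0, he0, h0⟩ := exists_not_adj_iff_of_isCubic_six hH 0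
  have hnon := exists_not_adj_iff_of_isCubic_six hH
  have hsymm := fun u v => H.adj_comm u v
  have hirr := fun u => H.irrefl (v := u)
  have other : ∀ u v w, ∃ x, x ≠ u ∧ x ≠ v ∧ x ≠ w ∧ x ≠ d ∧ x ≠ e := by
    intro u v w
    by_contra! hx
    have : (Finset.univ : Finset (Fin 6)) ⊆ {u, v, w, d, e} := fun x _ => by
      have := hx x
      simp only [Finset.mem_insert, Finset.mem_singleton]
      tauto
    have := (Finset.card_le_card this).trans Finset.card_le_five
    simp at this
  have second : ∀ v, v ≠ 0 → ¬ H.Adj v 0 →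
      ∃ i, i ≠ 0 ∧ i ≠ v ∧ ∀ x, H.Adj v x ↔ x ≠ v ∧ x ≠ 0 ∧ x ≠ i := by
    intro v hv hv0
    obtain ⟨p, q, hpq, hpv, hqv, h⟩ := hnon v
    have h0 := h 0
    by_cases hp : p = 0
    · exact ⟨q, by grind, hqv, by grind⟩
    · exact ⟨p, hp, hpv, by grind⟩
  obtain ⟨i, hi0, hid, hi⟩ := second d hd0 (by rw [hsymm, h0]; simp)
  obtain ⟨j, hj0, hje, hj⟩ := second e he0 (by rw [hsymm, h0]; simp)
  by_cases hie : i = e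
  · subst hie
    have hjd : j = d := by have := hsymm d i; grind
    subst hjd
    obtain ⟨a, ha⟩ := other 0 0 0
    obtain ⟨b, hb⟩ := other 0 a a
    obtain ⟨c, hc⟩ := other 0 a b
    exact ⟨0, a, j, b, i, c, by grind, by grind, by grind, by grind, by grind, by grind, by grind⟩
  · have hjd : j ≠ d := by have := hsymm d e; grind
    by_cases hij : i = j
    · subst hij
      obtain ⟨b, hb⟩ := other 0 i i
      obtain ⟨c, hc⟩ := other 0 i b
      have hic : H.Adj c i := by
        obtain ⟨p, q, hpq, -, -, h⟩ := hnon i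
        have := h d
        have := h e
        have := h c
        grind
      exact ⟨0, b, d, e, c, i, by grind, by grind, by grind, by grind, by grind, by grind, by grind⟩
    · obtain ⟨k, hk⟩ := other 0 i j
      have hki : ¬ H.Adj k i := by
        obtain ⟨p, q, r, hpq, hpr, hqr, h⟩ := exists_adj_iff_of_deg_eq_three (hH k)
        have h1 := h 0
        have h2 := h d
        have h3 := h e
        have h4 := h i
        rw [hsymm] at h1 h2 h3
        grind
      have hji : H.Adj j i := by
        obtain ⟨p, q, hpq, -, -, h⟩ := hnon i
        have := h d
        have := h k
        have := h j
        grind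
      exact ⟨0, k, e, d, j, i, by grind, by grind, by grind, by grind, by grind, by grind, by grind⟩

theorem exists_hamiltonian_evenFactor {m : ℕ} (hm : m = 4 ∨ m = 6) {H : SimpleGraph (Fin m)}
    (hH : IsCubic H) :
    ∃ F, IsEvenFactor H F ∧ (∀ v, deg F v = 2) ∧ cost F ≤ m + 2 := by
  rcases hm with rfl | rfl
  · have hadj : ∀ u v, u ≠ v → H.Adj u v := by
      intro u v huv
      by_contra hn
      have hsub : H.neighborSet u ⊆ {u, v}ᶜ := by
        rintro x hx (rfl | rfl)
        · exact H.irrefl hx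
        · exact hn hx
      have h1 := Set.ncard_le_ncard hsub (Set.toFinite _)
      have h2 := Set.ncard_add_ncard_compl ({u, v} : Set (Fin 4))
      rw [Set.ncard_pair huv, Nat.card_eq_fintype_card, Fintype.card_fin] at h2
      have h3 := hH u
      rw [deg_eq_ncard] at h3
      omega
    exact exists_evenFactor_of_hamiltonian (k := 1) Function.injective_id
      fun i => hadj _ _ (by revert i; decide)
  · obtain ⟨a, b, c, d, e, f, hnd, hab, hbc, hcd, hde, hef, hfa⟩ :=
      exists_hamiltonian_of_isCubic_six hH
    refine exists_evenFactor_of_hamiltonian (k := 3) (σ := ![a, b, c, d, e, f]) ?_ ?_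
    · exact List.nodup_ofFn.1 (by simpa [List.ofFn_succ] using hnd)
    · intro i
      fin_cases i
      exacts [hab, hbc, hcd, hde, hef, hfa]

end SmallCubic

section Extraction

variable {G : SimpleGraph V} {S : Set V}

theorem HasSpanningCycle.exists_five (h : HasSpanningCycle G S) (hS : Nat.card S = 5) :
    ∃ b₀ b₁ b₂ b₃ b₄, [b₀, b₁, b₂, b₃, b₄].Nodup ∧ S = {b₀, b₁, b₂, b₃, b₄} ∧
      G.Adj b₀ b₁ ∧ G.Adj b₁ b₂ ∧ G.Adj b₂ b₃ ∧ G.Adj b₃ b₄ ∧ G.Adj b₄ b₀ := by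
  classical
  obtain ⟨a, w, hw, hsupp⟩ := h
  have hlen : w.length = 5 := by
    have hset : S = (w.support.tail.toFinset : Set V) := by
      ext v
      rw [← hsupp, List.coe_toFinset, ← w.cons_tail_support, List.mem_cons, List.tail_cons]
      constructor
      · rintro (rfl | h)
        · exact w.end_mem_tail_support hw.not_nil
        · exact h
      · exact Or.inr
    rw [hset, Nat.card_coe_set_eq, Set.ncard_coe_finset, List.toFinset_card_of_nodup hw.support_nodup,
      List.length_tail, w.length_support] at hS
    exact hS
  have hnd := hw.support_nodup
  clear hw
  match w, hlen with
  | .cons (v := b₁) h₁ (.cons (v := b₂) h₂ (.cons (v := b₃) h₃ (.cons (v := b₄) h₄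
      (.cons h₅ .nil)))), _ =>
    simp only [Walk.support_cons, Walk.support_nil, List.tail_cons] at hnd hsupp
    refine ⟨a, b₁, b₂, b₃, b₄, by grind, ?_, h₁, h₂, h₃, h₄, h₅⟩
    ext v
    rw [← hsupp]
    simp only [List.mem_cons, List.not_mem_nil, Set.mem_insert_iff, Set.mem_singleton_iff]
    tauto

theorem IndepBoundary.eq_of_adj (h : IndepBoundary G S) {u u' v : V} (hu : u ∈ S) (hu' : u' ∈ S)
    (hv : v ∉ S) (huv : G.Adj u v) (hu'v : G.Adj u' v) : u = u' := by
  by_contra hne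
  refine h (x := s(u, v)) ⟨u, v, rfl, huv, hu, hv⟩ (y := s(u', v)) ⟨u', v, rfl, hu'v, hu', hv⟩ ?_
    v (by simp) (by simp)
  rw [Ne, Sym2.eq_iff]
  grind

theorem ncard_le_inducedEdges [Finite V] {A : Set (Sym2 V)}
    (hA : ∀ e ∈ A, e ∈ G.edgeSet ∧ ∀ v ∈ e, v ∈ S) : A.ncard ≤ inducedEdges G S :=
  Set.ncard_le_ncard (t := {e | e ∈ G.edgeSet ∧ ∀ v ∈ e, v ∈ S}) hA (Set.toFinite _)

/-- A chord that is the only one of its 5-circuit makes the circuit a house. -/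
theorem exists_isHouse_of_chord [Finite V] (hG : IsCubic G) (hE : inducedEdges G S = 6)
    (hind : IndepBoundary G S) {p q r s t : V} (hnd : [p, q, r, s, t].Nodup)
    (hS : S = {p, q, r, s, t}) (hqp : G.Adj q p) (hpr : G.Adj p r) (hrs : G.Adj r s)
    (hst : G.Adj s t) (htq : G.Adj t q) (hqr : G.Adj q r) :
    ∃ p q r s t x y z, IsHouse G S p q r s t x y z := by
  classical
  have hm : ∀ u, u ∈ S ↔ u = p ∨ u = q ∨ u = r ∨ u = s ∨ u = t := fun u => by simp [hS]
  have no_chord : ∀ u, u = s ∨ u = t → ¬ G.Adj p u := by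
    intro u hu hadj
    let A : List (Sym2 V) := [s(p, u), s(q, p), s(p, r), s(r, s), s(s, t), s(t, q), s(q, r)]
    have hA : A.Nodup := by
      simp only [A, List.nodup_cons, List.mem_cons, List.not_mem_nil, List.nodup_nil,
        Sym2.eq_iff] at hnd ⊢
      grind
    have := ncard_le_inducedEdges (G := G) (S := S) (A := A.toFinset) (by
      simp only [A, List.coe_toFinset, Set.mem_ofPred_eq, List.mem_cons, List.not_mem_nil, or_false]
      rintro e (rfl | rfl | rfl | rfl | rfl | rfl | rfl) <;>
        simp only [mem_edgeSet, Sym2.mem_iff] <;> grind)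
    rw [Set.ncard_coe_finset, List.toFinset_card_of_nodup hA] at this
    simp only [A, List.length_cons, List.length_nil] at this
    omega
  have hps := no_chord s (Or.inl rfl)
  have hpt := no_chord t (Or.inr rfl)
  have hsymm := fun u v => G.adj_comm u v
  have hirr := fun u => G.irrefl (v := u)
  have hq := adj_iff_of_deg_eq_three (p := p) (q := r) (r := t) (hG q) (by grind) (by grind)
    (by grind) hqp hqr htq.symm
  have hr := adj_iff_of_deg_eq_three (p := p) (q := q) (r := s) (hG r) (by grind) (by grind)
    (by grind) hpr.symm hqr.symm hrs
  obtain ⟨x, hqx, hrx, hp⟩ := exists_third_neighbor (p := q) (q := r) (hG p) (by grind)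
    hqp.symm hpr
  obtain ⟨y, hry, hty, hs⟩ := exists_third_neighbor (p := r) (q := t) (hG s) (by grind)
    hrs.symm hst
  obtain ⟨z, hqz, hsz, ht⟩ := exists_third_neighbor (p := q) (q := s) (hG t) (by grind)
    htq hst.symm
  have hpx : G.Adj p x := (hp x).2 (by simp)
  have hsy : G.Adj s y := (hs y).2 (by simp)
  have htz : G.Adj t z := (ht z).2 (by simp)
  have hx : x ∉ S := by
    rw [hm]
    rintro (rfl | rfl | rfl | rfl | rfl)
    exacts [hpx.ne rfl, hqx rfl, hrx rfl, hps hpx, hpt hpx]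
  have hy : y ∉ S := by
    rw [hm]
    rintro (rfl | rfl | rfl | rfl | rfl)
    · exact hps hsy.symm
    · have := (hq s).1 hsy.symm
      grind
    · exact hry rfl
    · exact hsy.ne rfl
    · exact hty rfl
  have hz : z ∉ S := by
    rw [hm]
    rintro (rfl | rfl | rfl | rfl | rfl)
    · exact hpt htz.symm
    · exact hqz rfl
    · have := (hr t).1 htz.symm
      grind
    · exact hsz rfl
    · exact htz.ne rfl
  have hpS := (hm p).2 (by simp)
  have hsS := (hm s).2 (by simp)
  have htS := (hm t).2 (by simp)
  have hxy : x ≠ y := by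
    rintro rfl
    have := hind.eq_of_adj hpS hsS hx hpx hsy
    grind
  have hxz : x ≠ z := by
    rintro rfl
    have := hind.eq_of_adj hpS htS hx hpx htz
    grind
  have hyz : y ≠ z := by
    rintro rfl
    have := hind.eq_of_adj hsS htS hy hsy htz
    grind
  refine ⟨p, q, r, s, t, x, y, z, ?_, hS, hp, hq, hr, hs, ht⟩
  rw [hm] at hx hy hz
  grind

theorem Type1Red.exists_isHouse [Finite V] (hG : IsCubic G) (h : Type1Red G S) :
    ∃ p q r s t x y z, IsHouse G S p q r s t x y z := by
  classical
  obtain ⟨hcyc, hcard, hE, hind⟩ := h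
  obtain ⟨b₀, b₁, b₂, b₃, b₄, hnd, hS, h₀, h₁, h₂, h₃, h₄⟩ := hcyc.exists_five hcard
  by_cases c₀ : G.Adj b₀ b₂
  · exact exists_isHouse_of_chord hG hE hind (p := b₁) (q := b₀) (r := b₂) (s := b₃) (t := b₄)
      (by grind) (by rw [hS]; grind) h₀ h₁ h₂ h₃ h₄ c₀
  by_cases c₁ : G.Adj b₁ b₃
  · exact exists_isHouse_of_chord hG hE hind (p := b₂) (q := b₁) (r := b₃) (s := b₄) (t := b₀)
      (by grind) (by rw [hS]; grind) h₁ h₂ h₃ h₄ h₀ c₁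
  by_cases c₂ : G.Adj b₂ b₄
  · exact exists_isHouse_of_chord hG hE hind (p := b₃) (q := b₂) (r := b₄) (s := b₀) (t := b₁)
      (by grind) (by rw [hS]; grind) h₂ h₃ h₄ h₀ h₁ c₂
  by_cases c₃ : G.Adj b₃ b₀
  · exact exists_isHouse_of_chord hG hE hind (p := b₄) (q := b₃) (r := b₀) (s := b₁) (t := b₂)
      (by grind) (by rw [hS]; grind) h₃ h₄ h₀ h₁ h₂ c₃
  by_cases c₄ : G.Adj b₄ b₁
  · exact exists_isHouse_of_chord hG hE hind (p := b₀) (q := b₄) (r := b₁) (s := b₂) (t := b₃)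
      (by grind) (by rw [hS]; grind) h₄ h₀ h₁ h₂ h₃ c₄
  exfalso
  let A : Finset (Sym2 V) := {s(b₀, b₁), s(b₁, b₂), s(b₂, b₃), s(b₃, b₄), s(b₄, b₀)}
  have hsub : {e | e ∈ G.edgeSet ∧ ∀ v ∈ e, v ∈ S} ⊆ (A : Set (Sym2 V)) := by
    rintro e ⟨he, heS⟩
    induction e with
    | h u v =>
    have hu := heS u (by simp)
    have hv := heS v (by simp)
    have huv : G.Adj u v := he
    have hvu := huv.symm
    simp only [hS, Set.mem_insert_iff, Set.mem_singleton_iff] at hu hv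
    simp only [A, Finset.coe_insert, Finset.coe_singleton, Set.mem_insert_iff,
        Set.mem_singleton_iff, Sym2.eq_iff]
    rcases hu with rfl | rfl | rfl | rfl | rfl <;> rcases hv with rfl | rfl | rfl | rfl | rfl <;>
      first
      | exact absurd huv G.irrefl
      | exact absurd huv (by assumption)
      | exact absurd hvu (by assumption)
      | simp
  have h5 := Set.ncard_le_ncard hsub (Set.toFinite _)
  rw [Set.ncard_coe_finset] at h5
  have h6 : A.card ≤ 5 := Finset.card_le_five
  have h7 : {e | e ∈ G.edgeSet ∧ ∀ v ∈ e, v ∈ S}.ncard = 6 := hE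
  omega

theorem exists_contractionMap {n : ℕ} {S : Set (Fin n)} (hS : Nat.card S = 5) :
    ∃ π : Fin n → Fin (n - 4), Function.Surjective π ∧
      ∀ u v, π u = π v ↔ u = v ∨ u ∈ S ∧ v ∈ S := by
  classical
  obtain ⟨a, ha⟩ : S.Nonempty := by
    refine Set.nonempty_of_ncard_ne_zero fun h => ?_
    rw [Nat.card_coe_set_eq, h] at hS
    omega
  let T : Set (Fin n) := insert a Sᶜ
  have hT : Nat.card T = n - 4 := by
    have h := Set.ncard_add_ncard_compl S
    rw [Nat.card_coe_set_eq] at hS ⊢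
    rw [Set.ncard_insert_of_notMem (by simpa using ha)]
    rw [Nat.card_fin, hS] at h
    omega
  let e : T ≃ Fin (n - 4) := Finite.equivFinOfCardEq hT
  let ρ : Fin n → T := fun v => if h : v ∈ S then ⟨a, Set.mem_insert a _⟩ else
    ⟨v, Set.mem_insert_of_mem a h⟩
  refine ⟨e ∘ ρ, e.surjective.comp ?_, fun u v => ?_⟩
  · rintro ⟨v, rfl | hv⟩
    · exact ⟨v, by simp [ρ, ha]⟩
    · exact ⟨v, by simp [ρ, show v ∉ S from hv]⟩
  · rw [Function.comp_apply, Function.comp_apply, e.injective.eq_iff, Subtype.ext_iff]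
    have hρ : ∀ v, (ρ v : Fin n) = if v ∈ S then a else v := fun v => by
      simp only [ρ]
      split_ifs <;> rfl
    rw [hρ, hρ]
    split_ifs <;> grind

end Extraction

/-- A smallest counterexample contains no type-1 reducible subgraph, i.e. no induced
5-circuit with a chord and an independent boundary. -/
theorem smallest_counterexample_no_type1 (n : ℕ) (G : SimpleGraph (Fin n))
    (hG : IsCounterexample n G)
    (hmin : ∀ (m : ℕ) (H : SimpleGraph (Fin m)), IsCounterexample m H → n ≤ m) :
    ¬ ∃ S : Set (Fin n), Type1Red G S := by
  rintro ⟨S, hS⟩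
  obtain ⟨hconn, hcub, hbr, hn, hno⟩ := hG
  obtain ⟨p, q, r, s, t, x, y, z, hH⟩ := hS.exists_isHouse hcub
  obtain ⟨π, hsurj, hπeq⟩ := exists_contractionMap hS.2.1
  have hπ : IsSimpleContraction G S π :=
    ⟨hsurj, hπeq, fun _ _ _ hu hu' hv => hS.2.2.2.eq_of_adj hu hu' hv⟩
  have hcub' := hH.isCubic_map hπ hcub
  have hcast : ((n - 4 : ℕ) : ℝ) = n - 4 := by
    rw [Nat.cast_sub (by omega)]
    norm_num
  have hn' : (8 : ℝ) ≤ n := by exact_mod_cast hn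
  by_cases hm : 8 ≤ n - 4
  · have hnc : ¬ IsCounterexample (n - 4) (G.map π) := fun h => by
      have := hmin _ _ h
      omega
    obtain ⟨F', hF', hcost'⟩ : ∃ F', IsEvenFactor (G.map π) F' ∧
        cost F' ≤ 1.3 * ((n - 4 : ℕ) : ℝ) := by
      by_contra hno'
      exact hnc ⟨hπ.connected_map hconn, hcub', hπ.bridgeless_map hconn hbr, hm, hno'⟩
    obtain ⟨F, hF, hcost⟩ := hH.exists_evenFactor hπ hF'
    refine hno ⟨F, hF, ?_⟩
    rw [Fintype.card_fin, Fintype.card_fin, hcast] at hcost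
    rw [hcast] at hcost'
    split_ifs at hcost <;> linarith
  · have heven := even_card_of_isCubic hcub'
    rw [Fintype.card_fin, Nat.even_iff] at heven
    obtain ⟨F', hF', hdeg, hcost'⟩ := exists_hamiltonian_evenFactor (by omega) hcub'
    obtain ⟨F, hF, hcost⟩ := hH.exists_evenFactor hπ hF'
    refine hno ⟨F, hF, ?_⟩
    rw [if_neg (by rw [hdeg]; decide), Fintype.card_fin, Fintype.card_fin, hcast] at hcost
    rw [hcast] at hcost'
    linarith
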